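/- Suppose K is of type D or of type E with constant m. Let n ≥ 1, a ∈ K*, A = K[X]/(X^{2^n} − a) with ḡ the image of X, s = H_n(a), and suppose s ≥ m and a ∈ K*^{2^s}; write a = b^{2^s} with b ∈ K*. Set λ = 1 if K is of type D and λ = −1 if K is of type E. Then all the coefficients appearing below lie in K, and the minimal idempotents of A are exactly: e_0 = (1/2^s)·Σ_{j=0}^{2^s−1} (b^{−1}·ḡ^{2^{n−s}})^j; e_{2^{m−2}} = (1/2^s)·Σ_{j=0}^{2^s−1} (−1)^j·(b^{−1}·ḡ^{2^{n−s}})^j; e_i = (1/2^s)·Σ_{j=0}^{2^s−1} (ε_{m−1}^{ij} + ε_{m−1}^{−ij})·(b^{−1}·ḡ^{2^{n−s}})^j for i = 1, 2, …, 2^{m−2} − 1; and e_{r,i} = (1/2^{s−r})·Σ_{j=0}^{2^{s−r}−1} (ε_m^{−j}·ε_{m−2}^{−ij} + λ^{j}·ε_m^{j}·ε_{m−2}^{ij})·(b^{−2^r}·ḡ^{2^{n−s+r}})^j for r = 0, 1, …, s − m and i = 0, 1, …, 2^{m−2} − 1. -/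

import Mathlib

noncomputable section

/-- `x ∈ K̄` lies in (the image of) the base field `K`. -/
def InK (K : Type*) [Field K] (x : AlgebraicClosure K) : Prop :=
  x ∈ Set.range (algebraMap K (AlgebraicClosure K))

/-- Type A: `ε₂ ∈ K` and `εₙ ∈ K` for every `n`. -/
def TypeA (K : Type*) [Field K] (ε : ℕ → AlgebraicClosure K) : Prop :=
  InK K (ε 2) ∧ ∀ n : ℕ, InK K (ε n)

/-- Type B: `ε₂ ∈ K` and there is a unique `m ≥ 2` with `ε_m ∈ K`, `ε_{m+1} ∉ K`. -/
def TypeB (K : Type*) [Field K] (ε : ℕ → AlgebraicClosure K) : Prop :=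
  InK K (ε 2) ∧ ∃! m : ℕ, 2 ≤ m ∧ InK K (ε m) ∧ ¬InK K (ε (m + 1))

/-- Type C: `ε₂ ∉ K` and `εₙ + εₙ⁻¹ ∈ K` for every `n`. -/
def TypeC (K : Type*) [Field K] (ε : ℕ → AlgebraicClosure K) : Prop :=
  ¬InK K (ε 2) ∧ ∀ n : ℕ, InK K (ε n + (ε n)⁻¹)

/-- Type D: `ε₂ ∉ K` and there is a unique `m ≥ 2` with `ε_m + ε_m⁻¹ ∈ K`,
`ε_{m+1} + ε_{m+1}⁻¹ ∉ K` and `ε_{m+1} - ε_{m+1}⁻¹ ∉ K`. -/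
def TypeD (K : Type*) [Field K] (ε : ℕ → AlgebraicClosure K) : Prop :=
  ¬InK K (ε 2) ∧ ∃! m : ℕ, 2 ≤ m ∧ InK K (ε m + (ε m)⁻¹) ∧
    ¬InK K (ε (m + 1) + (ε (m + 1))⁻¹) ∧ ¬InK K (ε (m + 1) - (ε (m + 1))⁻¹)

/-- Type E: `ε₂ ∉ K` and there is a unique `m ≥ 3` with `ε_m - ε_m⁻¹ ∈ K`. -/
def TypeE (K : Type*) [Field K] (ε : ℕ → AlgebraicClosure K) : Prop :=
  ¬InK K (ε 2) ∧ ∃! m : ℕ, 3 ≤ m ∧ InK K (ε m - (ε m)⁻¹)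

/-- Type B with constant `m`. -/
def TypeBc (K : Type*) [Field K] (ε : ℕ → AlgebraicClosure K) (m : ℕ) : Prop :=
  InK K (ε 2) ∧ 2 ≤ m ∧ InK K (ε m) ∧ ¬InK K (ε (m + 1))

/-- Type D with constant `m`. -/
def TypeDc (K : Type*) [Field K] (ε : ℕ → AlgebraicClosure K) (m : ℕ) : Prop :=
  ¬InK K (ε 2) ∧ 2 ≤ m ∧ InK K (ε m + (ε m)⁻¹) ∧
    ¬InK K (ε (m + 1) + (ε (m + 1))⁻¹) ∧ ¬InK K (ε (m + 1) - (ε (m + 1))⁻¹)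

/-- Type E with constant `m`. -/
def TypeEc (K : Type*) [Field K] (ε : ℕ → AlgebraicClosure K) (m : ℕ) : Prop :=
  ¬InK K (ε 2) ∧ 3 ≤ m ∧ InK K (ε m - (ε m)⁻¹)

/-- `a ∈ K_s = K* ∩ (K(ε₂)*)^{2^s}`: `a = α^{2^s}` for some `α ∈ K(ε₂)*`. -/
def MemKs (K : Type*) [Field K] (ε : ℕ → AlgebraicClosure K) (s : ℕ) (a : K) : Prop :=
  ∃ α : AlgebraicClosure K, α ∈ IntermediateField.adjoin K {ε 2} ∧ α ≠ 0 ∧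
    algebraMap K (AlgebraicClosure K) a = α ^ 2 ^ s

/-- A minimal idempotent of a commutative ring: a nonzero idempotent which is not
the sum of two nonzero orthogonal idempotents. -/
def IsMinIdem {A : Type*} [CommRing A] (e : A) : Prop :=
  e ≠ 0 ∧ e * e = e ∧
    ¬∃ e₁ e₂ : A, e₁ ≠ 0 ∧ e₂ ≠ 0 ∧ e₁ * e₁ = e₁ ∧ e₂ * e₂ = e₂ ∧
      e₁ * e₂ = 0 ∧ e = e₁ + e₂

open Polynomial IntermediateField in
/-- Over a field containing a square root of `-1`, the polynomial `X ^ 2 ^ k - a` is irreducible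
as soon as `a` is not a square. -/
theorem irreducible_X_pow_two_pow_sub_C {F : Type*} [Field F] (hF : ∃ i : F, i ^ 2 = -1)
    (k : ℕ) {a : F} (ha : ∀ c : F, c ^ 2 ≠ a) : Irreducible (X ^ 2 ^ k - C a) := by
  induction k generalizing F with
  | zero => simpa using irreducible_X_sub_C a
  | succ k ih =>
    rw [pow_succ]
    apply X_pow_mul_sub_C_irreducible (X_pow_sub_C_irreducible_of_prime Nat.prime_two ha)
    intro E _ _ x hx
    obtain ⟨i, hi⟩ := hF
    have hint : IsIntegral F x := not_not.mp fun h ↦ by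
      simpa only [degree_zero, degree_X_pow_sub_C Nat.two_pos,
        WithBot.natCast_ne_bot] using congr_arg degree (hx.symm.trans (dif_neg h))
    refine ih ⟨algebraMap F _ i, by rw [← map_pow, hi]; simp⟩ fun c hc ↦ ?_
    have hnorm : Algebra.norm F c ^ 2 = -a := by
      rw [← map_pow, hc, ← adjoin.powerBasis_gen hint,
        Algebra.PowerBasis.norm_gen_eq_coeff_zero_minpoly]
      simp [minpoly_gen, hx]
    exact ha (i * Algebra.norm F c) (by rw [mul_pow, hi, hnorm]; ring)

open Polynomial in
/-- Two solutions of `x ^ 2 ^ k = c` are roots of the same polynomials over the base field, when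
`X ^ 2 ^ k - c` is irreducible over an intermediate field containing `c`. -/
theorem aeval_eq_zero_of_pow_two_pow_eq {K Ω : Type*} [Field K] [Field Ω] [Algebra K Ω]
    (L : IntermediateField K Ω) (hL : ∃ i ∈ L, i ^ 2 = -1) {k : ℕ} {c : Ω} (hc : c ∈ L)
    (hsq : k = 0 ∨ ∀ v ∈ L, v ^ 2 ≠ c) {x y : Ω} (hx : x ^ 2 ^ k = c) (hy : y ^ 2 ^ k = c)
    {p : K[X]} (hp : aeval x p = 0) : aeval y p = 0 := by
  rcases hsq with rfl | hsq
  · simp only [pow_zero, pow_one] at hx hy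
    rwa [hy, ← hx]
  obtain ⟨i, hiL, hi⟩ := hL
  have hirr : Irreducible (X ^ 2 ^ k - C (⟨c, hc⟩ : L)) :=
    irreducible_X_pow_two_pow_sub_C ⟨⟨i, hiL⟩, Subtype.ext (by simpa using hi)⟩ k
      fun v hv ↦ hsq v v.2 (by simpa using congrArg Subtype.val hv)
  have hroot (z : Ω) (hz : z ^ 2 ^ k = c) : aeval z (X ^ 2 ^ k - C (⟨c, hc⟩ : L)) = 0 := by
    simp [hz, IntermediateField.algebraMap_apply]
  have hmin := minpoly.eq_of_irreducible_of_monic hirr (hroot x hx)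
    (monic_X_pow_sub_C _ (by positivity))
  have hdvd : minpoly L x ∣ p.map (algebraMap K L) := minpoly.dvd _ _ (by simpa using hp)
  rw [← hmin] at hdvd
  obtain ⟨q, hq⟩ := hdvd
  simpa [hroot y hy] using congrArg (aeval y) hq

/-- Every element of `K(i)`, where `i ^ 2 = -1`, has the form `p + q * i` with `p`, `q` in `K`. -/
theorem exists_eq_add_mul_of_mem_adjoin {K Ω : Type*} [Field K] [Field Ω] [Algebra K Ω] {i : Ω}
    (hi : i ^ 2 = -1) {u : Ω} (hu : u ∈ IntermediateField.adjoin K {i}) :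
    ∃ p q : K, u = algebraMap K Ω p + algebraMap K Ω q * i := by
  have hint : IsIntegral K i :=
    ⟨Polynomial.X ^ 2 + Polynomial.C 1, by monicity!, by simp [hi]⟩
  rw [← IntermediateField.mem_toSubalgebra,
    IntermediateField.adjoin_simple_toSubalgebra_of_isAlgebraic hint.isAlgebraic] at hu
  induction hu using Algebra.adjoin_induction with
  | mem x hx => exact ⟨0, 1, by simpa using hx⟩
  | algebraMap r => exact ⟨r, 0, by simp⟩
  | add x y _ _ hx hy =>
    obtain ⟨p, q, rfl⟩ := hx
    obtain ⟨p', q', rfl⟩ := hy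
    exact ⟨p + p', q + q', by push_cast [map_add]; ring⟩
  | mul x y _ _ hx hy =>
    obtain ⟨p, q, rfl⟩ := hx
    obtain ⟨p', q', rfl⟩ := hy
    refine ⟨p * p' - q * q', p * q' + q * p', ?_⟩
    simp only [map_add, map_sub, map_mul]
    linear_combination algebraMap K Ω q * algebraMap K Ω q' * hi

/-- If the homomorphisms to `Ω` separate points, an idempotent is minimal when the homomorphisms
not killing it are all conjugate. -/
theorem isMinIdem_of_forall_algHom {K A Ω : Type*} [Field K] [CommRing A] [Algebra K A] [Field Ω]
    [Algebra K Ω] (hsep : ∀ u : A, (∀ ψ : A →ₐ[K] Ω, ψ u = 0) → u = 0) {e : A}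
    (h01 : ∀ ψ : A →ₐ[K] Ω, ψ e = 0 ∨ ψ e = 1) (h1 : ∃ ψ : A →ₐ[K] Ω, ψ e = 1)
    (hconj : ∀ ψ ψ' : A →ₐ[K] Ω, ψ e = 1 → ψ' e = 1 → ∀ u, ψ u = 0 → ψ' u = 0) :
    IsMinIdem e := by
  obtain ⟨ψ₀, hψ₀⟩ := h1
  have hne : e ≠ 0 := by
    rintro rfl
    simp at hψ₀
  refine ⟨hne, sub_eq_zero.1 (hsep _ fun ψ ↦ ?_), ?_⟩
  · rcases h01 ψ with h | h <;> simp [h]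
  rintro ⟨e₁, e₂, h₁, h₂, -, -, h12, rfl⟩
  have hzero (ψ : A →ₐ[K] Ω) : ψ e₁ = 0 ∨ ψ e₂ = 0 := by
    rw [← mul_eq_zero, ← map_mul, h12, map_zero]
  have hkill (f : A) (hf : ψ₀ f = 0) (h : ∀ ψ : A →ₐ[K] Ω, ψ (e₁ + e₂) = 0 → ψ f = 0) : f = 0 :=
    hsep f fun ψ ↦ (h01 ψ).elim (h ψ) fun hψ ↦ hconj ψ₀ ψ hψ₀ hψ f hf
  rcases hzero ψ₀ with h | h
  · exact h₁ (hkill e₁ h fun ψ hψ ↦ (hzero ψ).elim id fun h' ↦ by simpa [h'] using hψ)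
  · exact h₂ (hkill e₂ h fun ψ hψ ↦ (hzero ψ).elim (fun h' ↦ by simpa [h'] using hψ) id)

theorem IsMinIdem.mul_eq_self {A : Type*} [CommRing A] {e f : A} (he : IsMinIdem e)
    (hf : f * f = f) (h : e * f ≠ 0) : e * f = e := by
  by_contra hne
  have hee := he.2.1
  refine he.2.2 ⟨e * f, e * (1 - f), h, fun h0 ↦ hne ?_, ?_, ?_, ?_, by ring⟩
  · linear_combination -h0
  · linear_combination f * f * hee + e * hf
  · linear_combination (1 - f) * (1 - f) * hee + e * hf
  · linear_combination -e * e * hf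

theorem IsMinIdem.eq_of_mul_ne_zero {A : Type*} [CommRing A] {e f : A} (he : IsMinIdem e)
    (hf : IsMinIdem f) (h : e * f ≠ 0) : e = f := by
  rw [← he.mul_eq_self hf.2.1 h, mul_comm, hf.mul_eq_self he.2.1 (by rwa [mul_comm])]

open Polynomial in
/-- The homomorphisms from `K[X] / (f)` to an algebraically closed field separate points when `f`
is separable. -/
theorem AdjoinRoot.eq_zero_of_forall_algHom {K Ω : Type*} [Field K] [Field Ω] [IsAlgClosed Ω]
    [Algebra K Ω] {f : K[X]} (hf : f.Separable) {u : AdjoinRoot f}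
    (hu : ∀ ψ : AdjoinRoot f →ₐ[K] Ω, ψ u = 0) : u = 0 := by
  obtain ⟨p, rfl⟩ := AdjoinRoot.mk_surjective u
  rw [AdjoinRoot.mk_eq_zero, ← map_dvd_map' (algebraMap K Ω)]
  by_cases hp : p = 0
  · simp [hp]
  have hf0 : f.map (algebraMap K Ω) ≠ 0 := by simpa using hf.ne_zero
  have hp0 : p.map (algebraMap K Ω) ≠ 0 := by simpa using hp
  rw [IsAlgClosed.dvd_iff_roots_le_roots hf0 hp0,
    Multiset.le_iff_subset (nodup_roots hf.map)]
  intro x hx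
  rw [mem_roots hf0, IsRoot.def, eval_map] at hx
  rw [mem_roots hp0, IsRoot.def, eval_map]
  exact hu (AdjoinRoot.liftAlgHom f (Algebra.ofId K Ω) x hx)

theorem inv_mul_geom_sum_of_pow_eq_one {F : Type*} [Field F] [DecidableEq F] {N : ℕ}
    (hN : (N : F) ≠ 0) {ω : F} (hω : ω ^ N = 1) :
    (N : F)⁻¹ * ∑ j ∈ Finset.range N, ω ^ j = if ω = 1 then 1 else 0 := by
  split_ifs with h
  · simp [h, hN]
  · rw [geom_sum_eq h, hω]
    simp

theorem exists_pow_two_pow_eq_neg_one {F : Type*} [Field F] {u : F} (hu : u ≠ 1) {k : ℕ}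
    (hk : u ^ 2 ^ (k + 1) = 1) : ∃ r ≤ k, u ^ 2 ^ r = -1 := by
  induction k generalizing u with
  | zero => exact ⟨0, le_rfl, by simpa [hu] using hk⟩
  | succ k ih =>
    by_cases h : u ^ 2 = 1
    · exact ⟨0, by omega, by simpa [hu] using h⟩
    · obtain ⟨r, hr, h'⟩ := ih h (by rw [← pow_mul, ← pow_succ']; exact hk)
      exact ⟨r + 1, by omega, by rw [pow_succ', pow_mul]; exact h'⟩

theorem pow_add_pow_mem {R : Type*} [CommRing R] {S : Subring R} {x y : R} (hadd : x + y ∈ S)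
    (hmul : x * y ∈ S) (k : ℕ) : x ^ k + y ^ k ∈ S := by
  induction k using Nat.twoStepInduction with
  | zero => simpa using add_mem S.one_mem S.one_mem
  | one => simpa using hadd
  | more k h0 h1 =>
    convert! sub_mem (mul_mem hadd h1) (mul_mem hmul h0) using 1
    ring

open Polynomial in
/-- The two roots of a quadratic polynomial over `K` without roots in `K` are conjugate. -/
theorem exists_algEquiv_apply_eq {K Ω : Type*} [Field K] [Field Ω] [Algebra K Ω] [Normal K Ω]
    {x y : Ω} (hadd : x + y ∈ (algebraMap K Ω).range) (hmul : x * y ∈ (algebraMap K Ω).range)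
    (hx : x ∉ (algebraMap K Ω).range) : ∃ σ : Ω ≃ₐ[K] Ω, σ x = y := by
  obtain ⟨d, hd⟩ := hadd
  obtain ⟨q, hq⟩ := hmul
  have hint : IsIntegral K x := Normal.isIntegral inferInstance x
  have hmonic : (X ^ 2 - C d * X + C q).Monic := by monicity!
  have hroot (z : Ω) (hz : (z - x) * (z - y) = 0) : aeval z (X ^ 2 - C d * X + C q) = 0 := by
    simp only [map_add, map_sub, map_mul, map_pow, aeval_X, aeval_C, hd, hq]
    linear_combination hz
  have hmin : X ^ 2 - C d * X + C q = minpoly K x := by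
    refine eq_of_monic_of_dvd_of_natDegree_le (minpoly.monic hint) hmonic
      (minpoly.dvd _ _ (hroot x (by simp))) ?_
    refine le_trans ?_ ((minpoly.two_le_natDegree_iff hint).2 hx)
    compute_degree
  have hconj : IsConjRoot K x y :=
    isConjRoot_of_aeval_eq_zero hint (by rw [← hmin]; exact hroot y (by simp))
  exact isConjRoot_iff_exists_algEquiv.1 hconj.symm

/-- If `t` generates `K(i)` with conjugate `l * t⁻¹`, `l = ± 1`, then `t` is not a square in `K(i)`
unless `l = 1` and `u + u⁻¹` or `u - u⁻¹` lies in `K` for a square root `u` of `t`. -/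
theorem sq_ne_of_mem_adjoin {K Ω : Type*} [Field K] [Field Ω] [Algebra K Ω] {i t l : Ω}
    (hi : i ^ 2 = -1) (hiK : i ∉ (algebraMap K Ω).range) {σ : Ω ≃ₐ[K] Ω} (hσi : σ i = -i)
    (ht : t ≠ 0) (hσt : σ t = l * t⁻¹)
    (hl : l = -1 ∨ l = 1 ∧ ∀ u, u ^ 2 = t →
      u + u⁻¹ ∉ (algebraMap K Ω).range ∧ u - u⁻¹ ∉ (algebraMap K Ω).range)
    {u : Ω} (hu : u ∈ IntermediateField.adjoin K {i}) : u ^ 2 ≠ t := by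
  intro hut
  obtain ⟨p, q, hpq⟩ := exists_eq_add_mul_of_mem_adjoin hi hu
  have hσu : σ u = algebraMap K Ω p - algebraMap K Ω q * i := by simp [hpq, hσi, sub_eq_add_neg]
  have hnorm : u * σ u = algebraMap K Ω (p ^ 2 + q ^ 2) := by
    simp only [hσu, map_add, map_pow]
    rw [hpq]
    linear_combination -algebraMap K Ω q ^ 2 * hi
  have htrace : u + σ u = algebraMap K Ω (2 * p) := by
    simp only [hσu, map_mul, map_ofNat]
    rw [hpq]
    ring
  have hu0 : u ≠ 0 := by
    rintro rfl
    exact ht (by simpa using hut.symm)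
  have hsq : (u * σ u) ^ 2 = l := by
    rw [mul_pow, ← map_pow, hut, hσt]
    field_simp
  rcases hl with rfl | ⟨rfl, hl⟩
  · have h : (u * σ u - i) * (u * σ u + i) = 0 := by linear_combination hsq - hi
    rcases mul_eq_zero.1 h with h | h
    · exact hiK ⟨p ^ 2 + q ^ 2, by linear_combination h - hnorm⟩
    · exact hiK ⟨-(p ^ 2 + q ^ 2), by rw [map_neg]; linear_combination hnorm - h⟩
  · rcases mul_self_eq_one_iff.1 ((sq _).symm.trans hsq) with h | h
    · exact (hl u hut).1 ⟨2 * p, by rw [← htrace, eq_inv_of_mul_eq_one_right h]⟩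
    · exact (hl u hut).2 ⟨2 * p, by
        rw [← htrace, ← eq_inv_of_mul_eq_one_right (b := -σ u) (by rw [mul_neg, h, neg_neg]),
          sub_neg_eq_add]⟩

theorem map_inv_two_pow_mul_sum {K A Ω : Type*} [Field K] [CommRing A] [Algebra K A] [Field Ω]
    [DecidableEq Ω] [Algebra K Ω] (h2 : (2 : K) ≠ 0) (k : ℕ) (S : Finset Ω)
    (hS : ∀ c ∈ S, c ^ 2 ^ k = 1) {w : ℕ → K}
    (hw : ∀ j, algebraMap K Ω (w j) = ∑ c ∈ S, c⁻¹ ^ j) (ψ : A →ₐ[K] Ω) {y : A}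
    (hy : ψ y ^ 2 ^ k = 1) :
    ψ (algebraMap K A (1 / 2 ^ k) * ∑ j ∈ Finset.range (2 ^ k), algebraMap K A (w j) * y ^ j) =
      if ψ y ∈ S then 1 else 0 := by
  have h2' : ((2 ^ k : ℕ) : Ω) ≠ 0 := by
    rw [← map_natCast (algebraMap K Ω), Ne, map_eq_zero, Nat.cast_pow, Nat.cast_ofNat]
    exact pow_ne_zero k h2
  have hterm (c : Ω) (hc : c ∈ S) : ((2 ^ k : ℕ) : Ω)⁻¹ *
      ∑ j ∈ Finset.range (2 ^ k), (c⁻¹ * ψ y) ^ j = if ψ y = c then 1 else 0 := by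
    have hc0 : c ≠ 0 := by
      rintro rfl
      simpa using hS 0 hc
    rw [inv_mul_geom_sum_of_pow_eq_one h2' (by rw [mul_pow, inv_pow, hS c hc, hy]; simp)]
    simp only [inv_mul_eq_one₀ hc0, eq_comm]
  calc _ = ∑ c ∈ S, ((2 ^ k : ℕ) : Ω)⁻¹ * ∑ j ∈ Finset.range (2 ^ k), (c⁻¹ * ψ y) ^ j := by
        simp only [map_mul, map_sum, AlgHom.commutes, map_pow, hw, mul_pow, ← Finset.mul_sum,
          Finset.sum_mul]
        rw [Finset.sum_comm]
        simp [map_ofNat]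
    _ = ∑ c ∈ S, if ψ y = c then 1 else 0 := Finset.sum_congr rfl hterm
    _ = _ := by simp

open Polynomial in
/-- The element cutting out the component of `K[X] / (X ^ 2 ^ n - b ^ 2 ^ s)` on which
`(b⁻¹ X ^ 2 ^ (n - s)) ^ 2 ^ r` is one of the conjugates `c`, `σ c` is a minimal idempotent. -/
theorem isMinIdem_of_conjugates {K Ω : Type*} [Field K] [Field Ω] [DecidableEq Ω] [IsAlgClosed Ω]
    [Algebra K Ω] (h2 : (2 : K) ≠ 0) {i : Ω} (hi : i ^ 2 = -1) (σ : Ω ≃ₐ[K] Ω) {a b : K}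
    {n s r : ℕ} (hb : b ≠ 0) (hab : a = b ^ 2 ^ s) (hsn : s ≤ n) (hrs : r ≤ s) {c : Ω}
    (hcL : c ∈ IntermediateField.adjoin K {i}) (hc : c ^ 2 ^ (s - r) = 1)
    (hsq : n - s + r = 0 ∨ ∀ v ∈ IntermediateField.adjoin K {i},
      v ^ 2 ≠ algebraMap K Ω b ^ 2 ^ r * c)
    {w : ℕ → K} (hw : ∀ j, algebraMap K Ω (w j) = ∑ x ∈ {c, σ c}, x⁻¹ ^ j)
    {e : AdjoinRoot (X ^ 2 ^ n - C a)}
    (he : e = algebraMap K _ (1 / 2 ^ (s - r)) * ∑ j ∈ Finset.range (2 ^ (s - r)),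
      algebraMap K _ (w j) * (algebraMap K _ (b⁻¹ ^ 2 ^ r) *
        AdjoinRoot.root (X ^ 2 ^ n - C a) ^ 2 ^ (n - s + r)) ^ j) :
    IsMinIdem e ∧ ∀ ψ : AdjoinRoot (X ^ 2 ^ n - C a) →ₐ[K] Ω,
      (algebraMap K Ω b)⁻¹ ^ 2 ^ r * ψ (AdjoinRoot.root _) ^ 2 ^ (n - s + r) ∈
        ({c, σ c} : Finset Ω) → ψ e = 1 := by
  set B := algebraMap K Ω b with hB
  have hB0 : B ≠ 0 := by simpa [hB] using hb
  have ha : a ≠ 0 := by simp [hab, hb]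
  have hroot (ψ : AdjoinRoot (X ^ 2 ^ n - C a) →ₐ[K] Ω) :
      ψ (AdjoinRoot.root _) ^ 2 ^ n = B ^ 2 ^ s := by
    rw [← map_pow, root_X_pow_sub_C_pow, ← AdjoinRoot.algebraMap_eq, AlgHom.commutes, hab, map_pow]
  have hsplit : 2 ^ n = 2 ^ (n - s + r) * 2 ^ (s - r) := by rw [← pow_add]; congr 1; omega
  have hsplit' : 2 ^ s = 2 ^ r * 2 ^ (s - r) := by rw [← pow_add]; congr 1; omega
  have heval (ψ : AdjoinRoot (X ^ 2 ^ n - C a) →ₐ[K] Ω) : ψ e =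
      if B⁻¹ ^ 2 ^ r * ψ (AdjoinRoot.root _) ^ 2 ^ (n - s + r) ∈ ({c, σ c} : Finset Ω)
        then 1 else 0 := by
    have hψ : ψ (algebraMap K _ (b⁻¹ ^ 2 ^ r) * AdjoinRoot.root _ ^ 2 ^ (n - s + r)) =
        B⁻¹ ^ 2 ^ r * ψ (AdjoinRoot.root _) ^ 2 ^ (n - s + r) := by
      simp only [map_mul, map_pow, AlgHom.commutes, map_inv₀, hB]
    rw [he, map_inv_two_pow_mul_sum h2 (s - r) {c, σ c} _ hw, hψ]
    · rw [hψ, mul_pow, ← pow_mul, ← pow_mul, ← hsplit, ← hsplit', hroot, ← mul_pow,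
        inv_mul_cancel₀ hB0, one_pow]
    · intro x hx
      rcases Finset.mem_insert.1 hx with rfl | hx
      · exact hc
      · rw [Finset.mem_singleton.1 hx, ← map_pow, hc, map_one]
  refine ⟨isMinIdem_of_forall_algHom (Ω := Ω)
    (fun u ↦ AdjoinRoot.eq_zero_of_forall_algHom
      (separable_X_pow_sub_C a (by simpa using pow_ne_zero n h2) ha))
    (fun ψ ↦ ?_) ?_ fun ψ ψ' hψ hψ' u hu ↦ ?_, fun ψ hψ ↦ by rw [heval, if_pos hψ]⟩
  · rw [heval]
    split_ifs <;> simp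
  · obtain ⟨x, hx⟩ := IsAlgClosed.exists_pow_nat_eq (B ^ 2 ^ r * c)
      (n := 2 ^ (n - s + r)) (by positivity)
    have hx' : x ^ 2 ^ n = algebraMap K Ω a := by
      rw [hsplit, pow_mul, hx, mul_pow, hc, ← pow_mul, ← hsplit', hab, map_pow, mul_one]
    refine ⟨AdjoinRoot.liftAlgHom _ (Algebra.ofId K Ω) x
      (by simp [hx']), ?_⟩
    rw [heval, if_pos]
    rw [AdjoinRoot.liftAlgHom_root, hx, ← mul_assoc, ← mul_pow, inv_mul_cancel₀ hB0]
    simp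
  · have hmem (χ : AdjoinRoot (X ^ 2 ^ n - C a) →ₐ[K] Ω) (hχ : χ e = 1) :
        ∃ τ : Ω ≃ₐ[K] Ω, τ (χ (AdjoinRoot.root _)) ^ 2 ^ (n - s + r) = B ^ 2 ^ r * c := by
      rw [heval] at hχ
      have h := of_not_not fun h ↦ zero_ne_one ((if_neg h).symm.trans hχ)
      rw [inv_pow, Finset.mem_insert, Finset.mem_singleton,
        inv_mul_eq_iff_eq_mul₀ (pow_ne_zero _ hB0), inv_mul_eq_iff_eq_mul₀ (pow_ne_zero _ hB0)] at h
      rcases h with h | h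
      · exact ⟨AlgEquiv.refl, h⟩
      · exact ⟨σ.symm, by rw [← map_pow, h]; simp [hB]⟩
    obtain ⟨τ, hτ⟩ := hmem ψ hψ
    obtain ⟨τ', hτ'⟩ := hmem ψ' hψ'
    obtain ⟨p, rfl⟩ := AdjoinRoot.mk_surjective u
    have hval (χ : AdjoinRoot (X ^ 2 ^ n - C a) →ₐ[K] Ω) :
        χ (AdjoinRoot.mk _ p) = aeval (χ (AdjoinRoot.root _)) p := by
      rw [aeval_algHom_apply, AdjoinRoot.aeval_eq]
    have hBL : B ^ 2 ^ r * c ∈ IntermediateField.adjoin K {i} :=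
      mul_mem (pow_mem (IntermediateField.algebraMap_mem _ b) _) hcL
    have h := aeval_eq_zero_of_pow_two_pow_eq (IntermediateField.adjoin K {i})
      ⟨i, IntermediateField.mem_adjoin_simple_self K i, hi⟩ hBL hsq hτ hτ' (p := p)
      (by rw [aeval_algHom_apply, ← hval, hu, map_zero])
    rw [aeval_algHom_apply, ← hval] at h
    simpa using h

/-- Theorem 3, case 3): `K` of type D or E with constant `m`, `s ≥ m` and
`a ∈ K*^{2^s}` (with `λ = 1` for type D and `λ = -1` for type E).  All the
coefficients below lie in `K` and the minimal idempotents of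
`A = K[X]/(X^{2^n} - a)` are exactly `e_0`, `e_{2^{m-2}}`,
`e_i = (1/2^s)·Σ_j (ε_{m-1}^{ij} + ε_{m-1}^{-ij})·(b⁻¹·ḡ^{2^{n-s}})^j` for
`1 ≤ i ≤ 2^{m-2} - 1`, and
`e_{r,i} = (1/2^{s-r})·Σ_j (ε_m^{-j}·ε_{m-2}^{-ij} + λ^j·ε_m^j·ε_{m-2}^{ij})·(b^{-2^r}·ḡ^{2^{n-s+r}})^j`
for `0 ≤ r ≤ s - m`, `0 ≤ i ≤ 2^{m-2} - 1`. -/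
theorem stmt_17 (K : Type*) [Field K] (h2 : (2 : K) ≠ 0)
    (ε : ℕ → AlgebraicClosure K)
    (hprim : ∀ n : ℕ, IsPrimitiveRoot (ε n) (2 ^ n))
    (hcomp : ∀ n : ℕ, ε (n + 1) ^ 2 = ε n)
    (m : ℕ) (lam : AlgebraicClosure K)
    (hcase : (TypeDc K ε m ∧ lam = 1) ∨ (TypeEc K ε m ∧ lam = -1))
    (n : ℕ) (hn : 1 ≤ n) (a : K) (ha : a ≠ 0)
    -- `s = H_n(a)`:
    (s : ℕ) (hsn : s ≤ n) (hmem : MemKs K ε s a)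
    (hmax : ∀ t : ℕ, t ≤ n → MemKs K ε t a → t ≤ s)
    (hms : m ≤ s)
    -- `a ∈ K*^{2^s}`, written `a = b^{2^s}`:
    (b : K) (hb : b ≠ 0) (hab : a = b ^ 2 ^ s)
    -- `ḡ` is the image of `X` in `A = K[X]/(X^{2^n} - a)`:
    (g : AdjoinRoot (Polynomial.X ^ 2 ^ n - Polynomial.C a))
    (hg : g = AdjoinRoot.root (Polynomial.X ^ 2 ^ n - Polynomial.C a))
    (φ : K →+* AdjoinRoot (Polynomial.X ^ 2 ^ n - Polynomial.C a))
    (hφ : φ = algebraMap K (AdjoinRoot (Polynomial.X ^ 2 ^ n - Polynomial.C a))) :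
    ∃ w₁ w₂ : ℕ → ℕ → K,
      (∀ i j : ℕ, algebraMap K (AlgebraicClosure K) (w₁ i j) =
        ε (m - 1) ^ (i * j) + (ε (m - 1))⁻¹ ^ (i * j)) ∧
      (∀ i j : ℕ, algebraMap K (AlgebraicClosure K) (w₂ i j) =
        (ε m)⁻¹ ^ j * (ε (m - 2))⁻¹ ^ (i * j) +
          lam ^ j * ε m ^ j * ε (m - 2) ^ (i * j)) ∧
      ∀ e : AdjoinRoot (Polynomial.X ^ 2 ^ n - Polynomial.C a),
        IsMinIdem e ↔
          (e = φ (1 / 2 ^ s) *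
              ∑ j ∈ Finset.range (2 ^ s), (φ b⁻¹ * g ^ 2 ^ (n - s)) ^ j ∨
          e = φ (1 / 2 ^ s) *
              ∑ j ∈ Finset.range (2 ^ s), φ ((-1) ^ j) * (φ b⁻¹ * g ^ 2 ^ (n - s)) ^ j ∨
          (∃ i : ℕ, 1 ≤ i ∧ i ≤ 2 ^ (m - 2) - 1 ∧
            e = φ (1 / 2 ^ s) *
              ∑ j ∈ Finset.range (2 ^ s), φ (w₁ i j) * (φ b⁻¹ * g ^ 2 ^ (n - s)) ^ j) ∨
          (∃ r : ℕ, r ≤ s - m ∧ ∃ i : ℕ, i < 2 ^ (m - 2) ∧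
            e = φ (1 / 2 ^ (s - r)) *
              ∑ j ∈ Finset.range (2 ^ (s - r)),
                φ (w₂ i j) * (φ (b⁻¹ ^ 2 ^ r) * g ^ 2 ^ (n - s + r)) ^ j)) := by
  classical
  subst hφ hg
  obtain ⟨M, rfl⟩ : ∃ M, m = M + 2 :=
    ⟨m - 2, by rcases hcase with ⟨⟨_, h, _⟩, _⟩ | ⟨⟨_, h, _⟩, _⟩ <;> omega⟩
  simp only [Nat.add_sub_cancel, show M + 2 - 1 = M + 1 from rfl]
  have hε0 (k : ℕ) : ε k ≠ 0 := (hprim k).ne_zero (by positivity)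
  have hε1 : ε 1 = -1 := (hprim 1).eq_neg_one_of_two_right
  have hi : ε 2 ^ 2 = -1 := by rw [hcomp, hε1]
  have h2' : (2 : AlgebraicClosure K) ≠ 0 := by
    rw [← map_ofNat (algebraMap K (AlgebraicClosure K))]
    simpa using h2
  have hiinv : (ε 2)⁻¹ = -ε 2 := inv_eq_of_mul_eq_one_right (by linear_combination -hi)
  have hεpow (j k : ℕ) : ε (j + k) ^ 2 ^ k = ε j := by
    induction k with
    | zero => simp
    | succ k ih => rw [pow_succ', pow_mul, ← add_assoc, hcomp, ih]
  have hti : ε (M + 2) ^ 2 ^ M = ε 2 := by rw [add_comm, hεpow]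
  have hM1 : ε (M + 1) = ε (M + 2) ^ 2 := (hcomp _).symm
  have hM0 : ε M = ε (M + 2) ^ 4 := by rw [← hcomp, hM1]; ring
  have hiK : ε 2 ∉ (algebraMap K (AlgebraicClosure K)).range := by
    rcases hcase with ⟨⟨h, _⟩, _⟩ | ⟨⟨h, _⟩, _⟩ <;> exact h
  have hlam2 : lam ^ 2 = 1 := by rcases hcase with ⟨_, rfl⟩ | ⟨_, rfl⟩ <;> ring
  have hlam0 : lam ≠ 0 := by rintro rfl; simp at hlam2
  have hlamM : lam ^ 2 ^ M = 1 := by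
    rcases hcase with ⟨_, rfl⟩ | ⟨⟨_, h, _⟩, rfl⟩
    · simp
    · obtain ⟨M, rfl⟩ : ∃ N, M = N + 1 := ⟨M - 1, by omega⟩
      rw [pow_succ', pow_mul, neg_one_sq, one_pow]
  have hlamK : lam ∈ (algebraMap K (AlgebraicClosure K)).range := by
    rcases hcase with ⟨_, rfl⟩ | ⟨_, rfl⟩
    · exact one_mem _
    · exact neg_mem (one_mem _)
  have htadd : ε (M + 2) + lam * (ε (M + 2))⁻¹ ∈ (algebraMap K (AlgebraicClosure K)).range := by
    rcases hcase with ⟨⟨_, _, h, _⟩, rfl⟩ | ⟨⟨_, _, h⟩, rfl⟩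
    · rwa [one_mul]
    · rwa [neg_one_mul, ← sub_eq_add_neg]
  have hl : lam = -1 ∨ lam = 1 ∧ ∀ u, u ^ 2 = ε (M + 2) →
      u + u⁻¹ ∉ (algebraMap K (AlgebraicClosure K)).range ∧
      u - u⁻¹ ∉ (algebraMap K (AlgebraicClosure K)).range := by
    rcases hcase with ⟨⟨_, _, _, h⟩, hl⟩ | ⟨_, hl⟩
    · refine Or.inr ⟨hl, fun u hu ↦ ?_⟩
      rw [← hcomp] at hu
      rcases sq_eq_sq_iff_eq_or_eq_neg.1 hu with rfl | rfl
      · exact h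
      · rw [inv_neg, ← neg_add, neg_sub_neg, ← neg_sub, neg_mem_iff, neg_mem_iff]
        exact h
    · exact Or.inl hl
  clear hcase
  generalize ht : ε (M + 2) = t at *
  have ht0 : t ≠ 0 := ht ▸ hε0 _
  have hmul : t * (lam * t⁻¹) ∈ (algebraMap K (AlgebraicClosure K)).range := by
    rwa [mul_left_comm, mul_inv_cancel₀ ht0, mul_one]
  have hpowadd := pow_add_pow_mem htadd hmul
  obtain ⟨σ, hσt⟩ := exists_algEquiv_apply_eq htadd hmul
    fun h ↦ hiK (hti ▸ pow_mem h (2 ^ M))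
  have hσi : σ (ε 2) = -ε 2 := by
    rw [← hiinv, ← hti, map_pow, hσt, mul_pow, hlamM, one_mul, inv_pow]
  have hKL (x : AlgebraicClosure K) (hx : x ∈ (algebraMap K (AlgebraicClosure K)).range) :
      x ∈ IntermediateField.adjoin K {ε 2} := by
    obtain ⟨y, rfl⟩ := hx
    exact IntermediateField.algebraMap_mem _ y
  have hiL : ε 2 ∈ IntermediateField.adjoin K {ε 2} :=
    IntermediateField.mem_adjoin_simple_self K _
  have htL : t ∈ IntermediateField.adjoin K {ε 2} := by
    have h1 := mul_mem hiL (hKL _ (hpowadd (2 ^ M + 1)))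
    have h2 := hKL _ htadd
    have h3 : t = (t + lam * t⁻¹ - ε 2 * (t ^ (2 ^ M + 1) + (lam * t⁻¹) ^ (2 ^ M + 1))) / 2 := by
      rw [pow_succ, pow_succ, hti, mul_pow, hlamM, inv_pow, hti, hiinv]
      field_simp
      linear_combination (t ^ 2 - lam) * hi
    rw [h3]
    exact div_mem (sub_mem h2 h1) (ofNat_mem _ 2)
  have hnsq (u : AlgebraicClosure K) (hu : u ∈ IntermediateField.adjoin K {ε 2}) : u ^ 2 ≠ t :=
    sq_ne_of_mem_adjoin hi hiK hσi ht0 hσt hl hu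
  have hw₁ (i j : ℕ) : ∃ w : K, algebraMap K (AlgebraicClosure K) w =
      ε (M + 1) ^ (i * j) + (ε (M + 1))⁻¹ ^ (i * j) := by
    have h := hpowadd (2 * (i * j))
    rw [mul_pow, pow_mul lam, hlam2, one_pow, one_mul, pow_mul t, pow_mul t⁻¹, inv_pow t, ← hM1] at h
    exact h
  have hw₂ (i j : ℕ) : ∃ w : K, algebraMap K (AlgebraicClosure K) w =
      t⁻¹ ^ j * (ε M)⁻¹ ^ (i * j) + lam ^ j * t ^ j * ε M ^ (i * j) := by
    have h := mul_mem (pow_mem hlamK j) (hpowadd (j + 4 * (i * j)))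
    have hlamj : lam ^ (j + 4 * (i * j)) = lam ^ j := by
      rw [pow_add, show 4 * (i * j) = 2 * (2 * (i * j)) by ring, pow_mul lam 2, hlam2]
      simp
    have hlamjj : lam ^ j * lam ^ j = 1 := by rw [← mul_pow, ← sq, hlam2, one_pow]
    obtain ⟨w, hw⟩ := h
    refine ⟨w, ?_⟩
    rw [hw, mul_pow, hlamj, mul_add, ← mul_assoc (lam ^ j) (lam ^ j), hlamjj, hM0]
    simp only [inv_pow, pow_add, ← pow_mul]
    field_simp
    ring
  choose w₁ hw₁ using hw₁
  choose w₂ hw₂ using hw₂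
  refine ⟨w₁, w₂, hw₁, hw₂, ?_⟩
  have hnonsq (c : AlgebraicClosure K) (hc : c ^ 2 ^ s = 1) : n - s + 0 = 0 ∨
      ∀ v ∈ IntermediateField.adjoin K {ε 2},
        v ^ 2 ≠ algebraMap K (AlgebraicClosure K) b ^ 2 ^ 0 * c := by
    by_contra! h
    obtain ⟨hns, v, hv, hvc⟩ := h
    have hva : algebraMap K (AlgebraicClosure K) a = v ^ 2 ^ (s + 1) := by
      rw [pow_succ', pow_mul, hvc, mul_pow, hc, hab]
      simp
    have := hmax (s + 1) (by omega) ⟨v, hv, by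
      rintro rfl
      simp [ha] at hva, hva⟩
    omega
  have hpow1 (c : AlgebraicClosure K) (k : ℕ) (hk : k ≤ s) (hc : c ^ 2 ^ k = 1) :
      c ^ 2 ^ s = 1 := by
    rw [← Nat.add_sub_cancel' hk, pow_add, pow_mul, hc, one_pow]
  have hσM1 (i : ℕ) : σ (ε (M + 1) ^ i) = (ε (M + 1) ^ i)⁻¹ := by
    rw [hM1, map_pow, map_pow, hσt, mul_pow, hlam2, one_mul, inv_pow, inv_pow]
  have hσM (i : ℕ) : σ (t * ε M ^ i) = lam * (t * ε M ^ i)⁻¹ := by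
    rw [hM0, map_mul, map_pow, map_pow, hσt, mul_pow, show lam ^ 4 = 1 by
      linear_combination (lam ^ 2 + 1) * hlam2, one_mul, mul_inv, inv_pow, inv_pow, mul_assoc]
  have hc₁ (i : ℕ) : (ε (M + 1) ^ i) ^ 2 ^ (M + 1) = 1 := by
    rw [pow_right_comm, (hprim _).pow_eq_one, one_pow]
  have hcM (i : ℕ) : (ε M ^ i) ^ 2 ^ M = 1 := by
    rw [pow_right_comm, (hprim _).pow_eq_one, one_pow]
  have hc₂ (i : ℕ) : (t * ε M ^ i) ^ 2 ^ M = ε 2 := by rw [mul_pow, hti, hcM, mul_one]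
  have hML (i : ℕ) : ε M ^ i ∈ IntermediateField.adjoin K {ε 2} :=
    hM0 ▸ pow_mem (pow_mem htL _) _
  have hE₀ := isMinIdem_of_conjugates h2 hi σ hb hab hsn (Nat.zero_le s) (c := 1) (one_mem _)
    (one_pow _) (hnonsq 1 (one_pow _)) (w := fun _ ↦ 1) (by simp) rfl
  have hneg1 : (-1 : AlgebraicClosure K) ^ 2 ^ s = 1 := hpow1 _ 1 (by omega) (by norm_num)
  have hE₁ := isMinIdem_of_conjugates h2 hi σ hb hab hsn (Nat.zero_le s) (c := -1)
    (neg_mem (one_mem _)) hneg1 (hnonsq _ hneg1) (w := fun j ↦ (-1) ^ j) (fun j ↦ by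
      rw [map_neg, map_one, Finset.pair_eq_singleton, Finset.sum_singleton, inv_neg_one]
      simp) rfl
  have hE₂ (i : ℕ) (hi1 : 1 ≤ i) (hi2 : i ≤ 2 ^ M - 1) :=
    isMinIdem_of_conjugates h2 hi σ hb hab hsn (Nat.zero_le s) (c := ε (M + 1) ^ i)
      (hM1 ▸ pow_mem (pow_mem htL _) _) (hpow1 _ _ (by omega) (hc₁ i))
      (hnonsq _ (hpow1 _ _ (by omega) (hc₁ i))) (w := w₁ i) (by
        intro j
        have hne : ε (M + 1) ^ i ≠ (ε (M + 1) ^ i)⁻¹ := by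
          intro h
          rw [← mul_eq_one_iff_eq_inv₀ (pow_ne_zero _ (hε0 _)), ← pow_add] at h
          have := Nat.le_of_dvd (by omega) ((hprim (M + 1)).dvd_of_pow_eq_one _ h)
          rw [pow_succ] at this
          omega
        rw [hw₁, hσM1, Finset.sum_pair hne, inv_inv, ← inv_pow, ← pow_mul, ← pow_mul, add_comm])
      rfl
  have hE₃ (r : ℕ) (hr : r ≤ s - (M + 2)) (i : ℕ) :=
    isMinIdem_of_conjugates h2 hi σ hb hab hsn (show r ≤ s by omega) (c := t * ε M ^ i)
      (mul_mem htL (hML i)) (by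
        rw [show s - r = M + (2 + (s - r - (M + 2))) by omega, pow_add, pow_mul, hc₂, pow_add,
          pow_mul, (hprim 2).pow_eq_one, one_pow]) (by
        rcases Nat.eq_zero_or_pos r with rfl | hr0
        · refine hnonsq _ (hpow1 _ (M + 2) hms ?_)
          rw [pow_add, pow_mul, hc₂, (hprim 2).pow_eq_one]
        · refine Or.inr fun v hv hvc ↦ hnsq
            (v / (algebraMap K (AlgebraicClosure K) b ^ 2 ^ (r - 1) * (t ^ 2) ^ i))
            (div_mem hv (mul_mem (pow_mem (IntermediateField.algebraMap_mem _ b) _)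
              (pow_mem (pow_mem htL _) _))) ?_
          have hb' : algebraMap K (AlgebraicClosure K) b ≠ 0 := by simpa using hb
          rw [div_pow, hvc, mul_pow, ← pow_mul, ← pow_succ, Nat.sub_add_cancel hr0, hM0]
          field_simp
          ring) (w := w₂ i) (by
        intro j
        have hne : t * ε M ^ i ≠ lam * (t * ε M ^ i)⁻¹ := by
          intro h
          have h' := congrArg (· ^ 2 ^ M) h
          simp only [mul_pow lam, hlamM, inv_pow, hc₂, hiinv, one_mul] at h'
          exact mul_ne_zero h2' (hε0 2) (by linear_combination h')
        have hlaminv : lam⁻¹ = lam := inv_eq_of_mul_eq_one_right (by rw [← sq, hlam2])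
        rw [hw₂, hσM, Finset.sum_pair hne, mul_inv lam, inv_inv, hlaminv, mul_inv, mul_pow,
          mul_pow, mul_pow, ← inv_pow, ← pow_mul, ← pow_mul, mul_assoc])
      rfl
  simp only [Nat.sub_zero, add_zero, pow_zero, pow_one, map_one, one_mul] at hE₀ hE₁ hE₂
  intro e
  constructor
  · intro he
    obtain ⟨ψ, hψ⟩ : ∃ ψ : AdjoinRoot (Polynomial.X ^ 2 ^ n - Polynomial.C a) →ₐ[K]
        AlgebraicClosure K, ψ e ≠ 0 := by
      by_contra! h
      exact he.1 (AdjoinRoot.eq_zero_of_forall_algHom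
        (Polynomial.separable_X_pow_sub_C a (by simpa using pow_ne_zero n h2) ha) h)
    have heq {f} (hf : IsMinIdem f ∧ ψ f = 1) : e = f :=
      he.eq_of_mul_ne_zero hf.1 fun h ↦ hψ (by
        have := congrArg ψ h
        rwa [map_mul, hf.2, mul_one, map_zero] at this)
    set η := (algebraMap K (AlgebraicClosure K) b)⁻¹ *
      ψ (AdjoinRoot.root (Polynomial.X ^ 2 ^ n - Polynomial.C a)) ^ 2 ^ (n - s) with hη
    have hη1 : η ^ 2 ^ s = 1 := by
      have hb' : algebraMap K (AlgebraicClosure K) b ≠ 0 := by simpa using hb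
      rw [hη, mul_pow, ← pow_mul, ← pow_add, Nat.sub_add_cancel hsn, ← map_pow,
        root_X_pow_sub_C_pow, ← AdjoinRoot.algebraMap_eq, AlgHom.commutes, hab, map_pow,
        ← mul_pow, inv_mul_cancel₀ hb', one_pow]
    by_cases hη2 : η ^ 2 ^ (M + 1) = 1
    · obtain ⟨k, hk, hkη⟩ := (hprim (M + 1)).eq_pow_of_pow_eq_one hη2
      have hpow := pow_succ 2 M
      rcases Nat.eq_zero_or_pos k with rfl | hk0
      · exact Or.inl (heq ⟨hE₀.1, hE₀.2 ψ (by rw [← hη, ← hkη]; simp)⟩)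
      rcases lt_trichotomy k (2 ^ M) with hlt | rfl | hgt
      · refine Or.inr (Or.inr (Or.inl ⟨k, hk0, by omega, heq ⟨(hE₂ k hk0 (by omega)).1,
          (hE₂ k hk0 (by omega)).2 ψ (by rw [← hη, ← hkη]; simp)⟩⟩))
      · refine Or.inr (Or.inl (heq ⟨hE₁.1, hE₁.2 ψ ?_⟩))
        rw [← hη, ← hkη, add_comm M, hεpow, hε1]
        simp
      · refine Or.inr (Or.inr (Or.inl ⟨2 ^ (M + 1) - k, by omega, by omega,
          heq ⟨(hE₂ _ (by omega) (by omega)).1, (hE₂ _ (by omega) (by omega)).2 ψ ?_⟩⟩))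
        have : ε (M + 1) ^ k = (ε (M + 1) ^ (2 ^ (M + 1) - k))⁻¹ := by
          rw [← mul_eq_one_iff_eq_inv₀ (pow_ne_zero _ (hε0 _)), ← pow_add,
            Nat.add_sub_cancel' hk.le, (hprim _).pow_eq_one]
        rw [hσM1, ← hη, ← hkη, this]
        simp
    · obtain ⟨r, hr, hr1⟩ := exists_pow_two_pow_eq_neg_one hη2 (k := s - (M + 2)) (by
        rw [← pow_mul, ← pow_add, show M + 1 + (s - (M + 2) + 1) = s by omega, hη1])
      refine Or.inr (Or.inr (Or.inr ⟨r, hr, ?_⟩))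
      have hcover : ∃ i < 2 ^ M, η ^ 2 ^ r = t * ε M ^ i ∨
          η ^ 2 ^ r = lam * (t * ε M ^ i)⁻¹ := by
        have key (ζ : AlgebraicClosure K) (hζ : ζ ^ 2 ^ M = ε 2) :
            ∃ i < 2 ^ M, ζ = t * ε M ^ i := by
          obtain ⟨i, hiM, h⟩ := (hprim M).eq_pow_of_pow_eq_one (ξ := ζ / t)
            (by rw [div_pow, hζ, hti, div_self (hε0 2)])
          exact ⟨i, hiM, by rw [h, mul_div_cancel₀ _ ht0]⟩
        have hsq : ((η ^ 2 ^ r) ^ 2 ^ M) ^ 2 = ε 2 ^ 2 := by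
          rw [hi, ← hr1]
          simp only [← pow_mul]
          congr 1
          ring
        have hη0 : η ≠ 0 := by
          rintro h
          simp [h] at hη1
        rcases sq_eq_sq_iff_eq_or_eq_neg.1 hsq with h | h
        · obtain ⟨i, hiM, h⟩ := key _ h
          exact ⟨i, hiM, Or.inl h⟩
        · obtain ⟨i, hiM, h⟩ := key (lam * (η ^ 2 ^ r)⁻¹) (by
            rw [mul_pow, hlamM, one_mul, inv_pow, h, inv_neg, hiinv, neg_neg])
          refine ⟨i, hiM, Or.inr ?_⟩
          rw [← h, mul_inv, inv_inv, ← mul_assoc, mul_inv_cancel₀ hlam0, one_mul]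
      obtain ⟨i, hiM, h⟩ := hcover
      refine ⟨i, hiM, heq ⟨(hE₃ r hr i).1, (hE₃ r hr i).2 ψ ?_⟩⟩
      rw [pow_add, pow_mul, ← mul_pow, ← hη, hσM]
      simpa using h
  · rintro (rfl | rfl | ⟨i, hi1, hi2, rfl⟩ | ⟨r, hr, i, -, rfl⟩)
    · exact hE₀.1
    · exact hE₁.1
    · exact (hE₂ i hi1 hi2).1
    · exact (hE₃ r hr i).1
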